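/- (Factorization through a density, Step 2.) Let 0<p<2 and α = 1/p − 1/2. There is a constant C, depending only on p, such that for every n, N and all matrices x_1,…,x_N ∈ M_n(ℂ) there exist a positive semidefinite f ∈ M_n(ℂ) with Tr f = 1 and matrices y_1,…,y_N ∈ M_n(ℂ) with x_k = (f^{α} y_k + y_k f^{α})/2 for every k and (∑_k ‖y_k‖_2^2)^{1/2} ≤ C |||x|||_p. -/

import Mathlib

open scoped BigOperators
open Matrix MeasureTheory
open scoped ComplexOrder

/-- `A^β` for a Hermitian (in practice positive semidefinite) matrix `A`, via the
spectral functional calculus (with the conventions of `Real.rpow` on eigenvalues,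
in particular `0 ^ β = 0` for `β ≠ 0`), extended by `0` to non-Hermitian matrices. -/
noncomputable def posPow {ι : Type*} [Fintype ι] [DecidableEq ι]
    (A : Matrix ι ι ℂ) (β : ℝ) : Matrix ι ι ℂ :=
  if hA : A.IsHermitian then hA.cfc (fun t => t ^ β) else 0

/-- Schatten `p`-(quasi)norm of a complex matrix: `(Tr((A*A)^(p/2)))^(1/p)`. -/
noncomputable def schattenNorm {ι : Type*} [Fintype ι] [DecidableEq ι]
    (p : ℝ) (A : Matrix ι ι ℂ) : ℝ :=
  ((posPow (Aᴴ * A) (p / 2)).trace.re) ^ (1 / p)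

/-- Operator norm of a matrix, acting on the Euclidean space. -/
noncomputable def opNorm {ι : Type*} [Fintype ι] [DecidableEq ι]
    (A : Matrix ι ι ℂ) : ℝ :=
  ‖Matrix.toEuclideanCLM (𝕜 := ℂ) A‖

/-- The quantity `|||x|||_p` for `0 < p ≤ 2`: the infimum of
`‖(∑ aₖ*aₖ)^(1/2)‖_p + ‖(∑ bₖbₖ*)^(1/2)‖_p` over decompositions `xₖ = aₖ + bₖ`. -/
noncomputable def tripleNorm {n N : ℕ} (p : ℝ)
    (x : Fin N → Matrix (Fin n) (Fin n) ℂ) : ℝ :=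
  sInf { r : ℝ | ∃ a b : Fin N → Matrix (Fin n) (Fin n) ℂ,
    (∀ k, x k = a k + b k) ∧
    r = schattenNorm p (posPow (∑ k, (a k)ᴴ * a k) (1/2))
        + schattenNorm p (posPow (∑ k, b k * (b k)ᴴ) (1/2)) }

/-- `E_ε ‖∑ ε_k x_k‖_p ^ p`, the average over a uniformly random choice of signs. -/
noncomputable def radAvg {n N : ℕ} (p : ℝ)
    (x : Fin N → Matrix (Fin n) (Fin n) ℂ) : ℝ :=
  (1 / 2 ^ N) * ∑ ε : Fin N → Bool,
    (schattenNorm p (∑ k, (if ε k then (1 : ℂ) else -1) • x k)) ^ p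

lemma sum_div_mul_rpow_le {ι : Type*} [Fintype ι] {q : ℝ} (hq0 : 0 < q)
    (hq1 : q ≤ 1) {l g : ι → ℝ} (hl : ∀ i, 0 ≤ l i) (hg : ∀ j, 0 ≤ g j) {W : ι → ι → ℂ}
    (hW : ∀ i, ∑ j, ‖W i j‖ ^ 2 = 1)
    (H : ∀ u : ι → ℂ, ∑ i, l i * ‖∑ j, W i j * u j‖ ^ 2 ≤ ∑ j, g j * ‖u j‖ ^ 2) :
    ∑ j, (∑ i, l i * ‖W i j‖ ^ 2) / g j * g j ^ q ≤ ∑ i, l i ^ q := by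
  classical
  have h1 (j) : ∑ i, l i * ‖W i j‖ ^ 2 ≤ g j := by
    have := H (Pi.single j 1)
    simpa [Pi.single_apply, apply_ite] using this
  have h2 (i j) (h : g j = 0) : l i * ‖W i j‖ ^ 2 = 0 := by
    have h0 : ∀ i ∈ Finset.univ, 0 ≤ l i * ‖W i j‖ ^ 2 :=
      fun i _ => mul_nonneg (hl i) (by positivity)
    exact (Finset.sum_eq_zero_iff_of_nonneg h0).1
      (le_antisymm ((h1 j).trans h.le) (Finset.sum_nonneg h0)) i (Finset.mem_univ _)
  have h3 (i) : ∑ j, l i * ‖W i j‖ ^ 2 / g j ≤ 1 := by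
    set s := ∑ j, ‖W i j‖ ^ 2 / g j with hs
    have hs0 : 0 ≤ s := Finset.sum_nonneg fun j _ => div_nonneg (by positivity) (hg j)
    have hsum : ∑ j, l i * ‖W i j‖ ^ 2 / g j = l i * s := by
      simp_rw [hs, Finset.mul_sum, mul_div_assoc]
    rw [hsum]
    have hu := H fun j => star (W i j) / g j
    have e1 : ∑ j, W i j * (star (W i j) / (g j : ℂ)) = (s : ℂ) := by
      rw [hs]; push_cast
      refine Finset.sum_congr rfl fun j _ => ?_
      rw [← mul_div_assoc]
      congr 1
      exact Complex.mul_conj' _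
    have e2 : ∑ j, g j * ‖star (W i j) / (g j : ℂ)‖ ^ 2 = s := by
      refine Finset.sum_congr rfl fun j _ => ?_
      rw [norm_div, norm_star, Complex.norm_real, div_pow, Real.norm_eq_abs, sq_abs]
      rcases eq_or_ne (g j) 0 with h | h
      · simp [h]
      · field_simp
    rw [e2] at hu
    have h4 : l i * s ^ 2 ≤ s := by
      refine le_trans ?_ hu
      have := Finset.single_le_sum
        (f := fun i' => l i' * ‖∑ j, W i' j * (star (W i j) / (g j : ℂ))‖ ^ 2)
        (fun i' _ => mul_nonneg (hl i') (by positivity)) (Finset.mem_univ i)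
      simp only [e1, Complex.norm_real, Real.norm_eq_abs, sq_abs] at this
      exact this
    rcases hs0.eq_or_lt with h | h
    · rw [← h]; simp
    · nlinarith
  have h4 (i) : ∑ j, l i * ‖W i j‖ ^ 2 / g j * g j = l i := by
    calc _ = ∑ j, l i * ‖W i j‖ ^ 2 := Finset.sum_congr rfl fun j _ => by
          rcases eq_or_ne (g j) 0 with h | h
          · rw [h2 i j h]; simp
          · field_simp
      _ = l i := by rw [← Finset.mul_sum, hW, mul_one]
  calc _ = ∑ i, ∑ j, l i * ‖W i j‖ ^ 2 / g j * g j ^ q := by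
        rw [Finset.sum_comm]
        simp_rw [Finset.sum_div, Finset.sum_mul]
    _ ≤ ∑ i, l i ^ q := Finset.sum_le_sum fun i _ => ?_
  have hc (j) : 0 ≤ l i * ‖W i j‖ ^ 2 / g j :=
    div_nonneg (mul_nonneg (hl i) (by positivity)) (hg j)
  have := Real.inner_le_weight_mul_Lp_of_nonneg Finset.univ (one_le_inv_iff₀.2 ⟨hq0, hq1⟩)
    (fun j => l i * ‖W i j‖ ^ 2 / g j) (fun j => g j ^ q) hc
    (fun j => Real.rpow_nonneg (hg j) q)
  refine this.trans ?_
  simp_rw [Real.rpow_rpow_inv (hg _) hq0.ne', inv_inv, h4 i]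
  exact mul_le_of_le_one_left (Real.rpow_nonneg (hl i) q)
    (Real.rpow_le_one (Finset.sum_nonneg fun j _ => hc j) (h3 i) (by linarith))

lemma Real.sum_rpow_le {ι : Type*} (s : Finset ι) {q : ℝ} (hq0 : 0 < q) (hq1 : q ≤ 1) {l : ι → ℝ}
    (hl : ∀ i, 0 ≤ l i) : (∑ i ∈ s, l i) ^ q ≤ ∑ i ∈ s, l i ^ q :=
  Finset.le_sum_of_subadditive_on_pred (fun x : ℝ => x ^ q) (fun x => 0 ≤ x)
    (Real.zero_rpow hq0.ne').le (fun _ _ hx hy => Real.rpow_add_le_add_rpow hx hy hq0.le hq1)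
    (fun _ _ hx hy => add_nonneg hx hy) l fun i _ => hl i


lemma trace_conjTranspose_mul_self_re {ι : Type*} [Fintype ι] (A : Matrix ι ι ℂ) :
    (Aᴴ * A).trace.re = ∑ j, ∑ i, ‖A i j‖ ^ 2 := by
  simp only [trace, diag_apply, mul_apply, conjTranspose_apply, Complex.re_sum]
  refine Finset.sum_congr rfl fun j _ => Finset.sum_congr rfl fun i _ => ?_
  have := Complex.conj_mul' (A i j)
  simp only [RCLike.star_def, this]
  norm_cast

section
variable {ι : Type*} [Fintype ι] [DecidableEq ι]

lemma posPow_eq_cfc (A : Matrix ι ι ℂ) (β : ℝ) : posPow A β = cfc (fun t : ℝ => t ^ β) A := by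
  unfold posPow
  split_ifs with hA
  · rw [hA.cfc_eq]
  · exact (cfc_apply_of_not_predicate A hA).symm

lemma Matrix.IsHermitian.cfc_eq_mul {A : Matrix ι ι ℂ} (hA : A.IsHermitian) (φ : ℝ → ℝ) :
    cfc φ A = (hA.eigenvectorUnitary : Matrix ι ι ℂ) *
      diagonal (fun i => (φ (hA.eigenvalues i) : ℂ)) *
      (hA.eigenvectorUnitary : Matrix ι ι ℂ)ᴴ := by
  rw [hA.cfc_eq]; rfl

lemma posPow_cfc {A : Matrix ι ι ℂ} (hA : A.IsHermitian) (φ : ℝ → ℝ) (β : ℝ) :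
    posPow (cfc φ A) β = cfc (fun t => φ t ^ β) A := by
  rw [posPow_eq_cfc, cfc_comp' (fun t : ℝ => t ^ β) φ A
    ((A.finite_real_spectrum.image φ).continuousOn _) (A.finite_real_spectrum.continuousOn _) hA.isSelfAdjoint]

lemma trace_cfc {A : Matrix ι ι ℂ} (hA : A.IsHermitian) (φ : ℝ → ℝ) :
    (cfc φ A).trace = ((∑ i, φ (hA.eigenvalues i) : ℝ) : ℂ) := by
  rw [hA.cfc_eq_mul, trace_mul_comm, ← mul_assoc, ← star_eq_conjTranspose,
    Unitary.coe_star_mul_self, one_mul, trace_diagonal]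
  push_cast
  rfl

lemma posPow_half_mul_self {A : Matrix ι ι ℂ} (hA : A.PosSemidef) :
    (posPow A (1 / 2))ᴴ * posPow A (1 / 2) = A := by
  have h : (posPow A (1 / 2))ᴴ = posPow A (1 / 2) := by
    rw [posPow_eq_cfc, ← star_eq_conjTranspose]
    exact (cfc_predicate (p := IsSelfAdjoint) (fun t : ℝ => t ^ (1 / 2 : ℝ)) A)
  rw [h, posPow_eq_cfc, ← cfc_mul _ _ A (A.finite_real_spectrum.continuousOn _)
    (A.finite_real_spectrum.continuousOn _)]
  conv_rhs => rw [← cfc_id ℝ A hA.1.isSelfAdjoint]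
  refine cfc_congr fun t ht => ?_
  rw [hA.1.spectrum_real_eq_range_eigenvalues] at ht
  obtain ⟨i, rfl⟩ := ht
  simp only [id]
  rw [← Real.sqrt_eq_rpow, Real.mul_self_sqrt (hA.eigenvalues_nonneg i)]

lemma schattenNorm_posPow_half {A : Matrix ι ι ℂ} (hA : A.PosSemidef) (p : ℝ) :
    schattenNorm p (posPow A (1 / 2)) = (∑ i, hA.1.eigenvalues i ^ (p / 2)) ^ (1 / p) := by
  rw [schattenNorm, posPow_half_mul_self hA, posPow_eq_cfc, trace_cfc hA.1, Complex.ofReal_re]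

lemma schattenNorm_two_sq (A : Matrix ι ι ℂ) :
    schattenNorm 2 A ^ 2 = (Aᴴ * A).trace.re := by
  have h : posPow (Aᴴ * A) (2 / 2) = Aᴴ * A := by
    rw [posPow_eq_cfc, div_self two_ne_zero]
    simp only [Real.rpow_one]
    exact cfc_id' ℝ _ (isHermitian_conjTranspose_mul_self A).isSelfAdjoint
  rw [schattenNorm, h, ← Real.sqrt_eq_rpow, Real.sq_sqrt]
  rw [trace_conjTranspose_mul_self_re]
  positivity

lemma Matrix.IsHermitian.re_dotProduct_mulVec_eq {A : Matrix ι ι ℂ} (hA : A.IsHermitian)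
    (w : ι → ℂ) : (star w ⬝ᵥ (A *ᵥ w)).re =
      ∑ i, hA.eigenvalues i * ‖((hA.eigenvectorUnitary : Matrix ι ι ℂ)ᴴ *ᵥ w) i‖ ^ 2 := by
  have h := hA.cfc_eq_mul id
  rw [cfc_id ℝ A hA.isSelfAdjoint] at h
  set V := (hA.eigenvectorUnitary : Matrix ι ι ℂ)
  conv_lhs => rw [h]
  rw [← mulVec_mulVec, ← mulVec_mulVec, dotProduct_mulVec]
  have : star w ᵥ* V = star (Vᴴ *ᵥ w) := by rw [star_mulVec, conjTranspose_conjTranspose]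
  rw [this]
  simp only [dotProduct, mulVec_diagonal, Complex.re_sum, id]
  refine Finset.sum_congr rfl fun i _ => ?_
  have := Complex.conj_mul' ((Vᴴ *ᵥ w) i)
  simp only [Pi.star_apply, RCLike.star_def]
  rw [mul_left_comm, this]
  norm_cast

lemma Matrix.IsHermitian.diag_eq {A : Matrix ι ι ℂ} (hA : A.IsHermitian) (j : ι) :
    (((hA.eigenvectorUnitary : Matrix ι ι ℂ)ᴴ * A *
      (hA.eigenvectorUnitary : Matrix ι ι ℂ)) j j).re = hA.eigenvalues j := by
  have h := hA.conjStarAlgAut_star_eigenvectorUnitary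
  rw [Unitary.conjStarAlgAut_star_apply] at h
  have h' := congrFun (congrFun h j) j
  simp only [star_eq_conjTranspose] at h'
  rw [h']
  simp

lemma sum_diag_div_mul_rpow_le {P Q : Matrix ι ι ℂ} (hP : P.PosSemidef) (hQ : Q.PosSemidef)
    (hG : (P + Q).PosSemidef) {q : ℝ} (hq0 : 0 < q) (hq1 : q ≤ 1) :
    ∑ j, (((hG.1.eigenvectorUnitary : Matrix ι ι ℂ)ᴴ * P *
        (hG.1.eigenvectorUnitary : Matrix ι ι ℂ)) j j).re / hG.1.eigenvalues j *
          hG.1.eigenvalues j ^ q ≤ ∑ i, hP.1.eigenvalues i ^ q := by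
  set U := (hG.1.eigenvectorUnitary : Matrix ι ι ℂ) with hU
  set V := (hP.1.eigenvectorUnitary : Matrix ι ι ℂ) with hV
  have hUU : Uᴴ * U = 1 := Unitary.coe_star_mul_self _
  have hU' : U * Uᴴ = 1 := Unitary.coe_mul_star_self _
  have hVV : Vᴴ * V = 1 := Unitary.coe_star_mul_self _
  have key (u : ι → ℂ) : (star (U *ᵥ u) ⬝ᵥ (P *ᵥ (U *ᵥ u))).re =
      ∑ i, hP.1.eigenvalues i * ‖∑ j, (Vᴴ * U) i j * u j‖ ^ 2 := by
    rw [hP.1.re_dotProduct_mulVec_eq, mulVec_mulVec]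
    rfl
  have hdiag (j) : ((Uᴴ * P * U) j j).re =
      ∑ i, hP.1.eigenvalues i * ‖(Vᴴ * U) i j‖ ^ 2 := by
    have := key (Pi.single j 1)
    simp only [Pi.single_apply, mul_ite, mul_one, mul_zero, Finset.sum_ite_eq',
      Finset.mem_univ, if_true] at this
    rw [← this, mulVec_mulVec, star_mulVec, dotProduct_mulVec, vecMul_vecMul, ← mul_assoc,
      ← dotProduct_mulVec]
    simp
  simp_rw [hdiag]
  refine sum_div_mul_rpow_le hq0 hq1 hP.eigenvalues_nonneg hG.eigenvalues_nonneg
    (W := fun i j => (Vᴴ * U) i j) (fun i => ?_) fun u => ?_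
  · have h1 : (Vᴴ * U) * (Vᴴ * U)ᴴ = 1 := by
      rw [conjTranspose_mul, conjTranspose_conjTranspose, mul_assoc, ← mul_assoc U, hU', one_mul,
        hVV]
    have h2 := congrFun (congrFun h1 i) i
    simp only [mul_apply (M := Vᴴ * U), conjTranspose_apply (M := Vᴴ * U), RCLike.star_def,
      Complex.mul_conj', one_apply_eq] at h2
    exact_mod_cast h2
  · rw [← key]
    have h1 := hG.1.re_dotProduct_mulVec_eq (U *ᵥ u)
    rw [← hU, mulVec_mulVec u Uᴴ U, hUU, one_mulVec, add_mulVec, dotProduct_add,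
      Complex.add_re] at h1
    have h2 := (Complex.le_def.1 (hQ.dotProduct_mulVec_nonneg (U *ᵥ u))).1
    rw [Complex.zero_re] at h2
    linarith

lemma sum_eigenvalues_add_rpow_le {P Q : Matrix ι ι ℂ} (hP : P.PosSemidef) (hQ : Q.PosSemidef)
    (hG : (P + Q).PosSemidef) {q : ℝ} (hq0 : 0 < q) (hq1 : q ≤ 1) :
    ∑ j, hG.1.eigenvalues j ^ q ≤
      ∑ i, hP.1.eigenvalues i ^ q + ∑ i, hQ.1.eigenvalues i ^ q := by
  have h1 := sum_diag_div_mul_rpow_le hP hQ hG hq0 hq1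
  have hG' : (Q + P).PosSemidef := by rwa [add_comm]
  have h2 := sum_diag_div_mul_rpow_le hQ hP hG' hq0 hq1
  have e : P + Q = Q + P := add_comm P Q
  simp only [← e] at h2
  refine le_trans (le_of_eq ?_) (add_le_add h1 h2)
  rw [← Finset.sum_add_distrib]
  refine Finset.sum_congr rfl fun j _ => ?_
  rw [← add_mul, ← add_div, ← Complex.add_re, ← Matrix.add_apply, ← add_mul, ← mul_add]
  rw [hG.1.diag_eq]
  rcases eq_or_ne (hG.1.eigenvalues j) 0 with h | h
  · simp [h, Real.zero_rpow hq0.ne']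
  · rw [div_self h, one_mul]

lemma norm_two_mul_add_div_sq_le {a b : ℂ} {c d : ℝ} (hc : 0 ≤ c) (hd : 0 ≤ d)
    (ha : d = 0 → a = 0) (hb : c = 0 → b = 0) :
    ‖2 * (a + b) / ((c + d : ℝ) : ℂ)‖ ^ 2 ≤ 8 * (‖a‖ ^ 2 / d ^ 2 + ‖b‖ ^ 2 / c ^ 2) := by
  have h1 : ‖a‖ / (c + d) ≤ ‖a‖ / d := by
    rcases hd.eq_or_lt with h | h
    · simp [ha h.symm]
    · gcongr; linarith
  have h2 : ‖b‖ / (c + d) ≤ ‖b‖ / c := by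
    rcases hc.eq_or_lt with h | h
    · simp [hb h.symm]
    · gcongr; linarith
  have h3 : ‖2 * (a + b) / ((c + d : ℝ) : ℂ)‖ ≤ 2 * (‖a‖ / d + ‖b‖ / c) := by
    rw [norm_div, norm_mul, Complex.norm_real, Real.norm_of_nonneg (add_nonneg hc hd),
      Complex.norm_two, mul_div_assoc]
    gcongr
    calc ‖a + b‖ / (c + d) ≤ (‖a‖ + ‖b‖) / (c + d) := by gcongr; exact norm_add_le a b
      _ ≤ _ := by rw [add_div]; exact add_le_add h1 h2
  calc _ ≤ (2 * (‖a‖ / d + ‖b‖ / c)) ^ 2 := by gcongr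
    _ ≤ 8 * ((‖a‖ / d) ^ 2 + (‖b‖ / c) ^ 2) := by nlinarith [sq_nonneg (‖a‖ / d - ‖b‖ / c)]
    _ = _ := by rw [div_pow, div_pow]

lemma div_rpow_sq_eq {p α g T : ℝ} (hp0 : 0 < p) (hα : α = 1 / p - 1 / 2) (hg : 0 ≤ g)
    (hT : 0 < T) : g / ((g ^ (p / 2) / T) ^ α) ^ 2 = g ^ (p / 2) * T ^ (2 / p - 1) := by
  rcases hg.eq_or_lt with rfl | hg
  · rw [Real.zero_rpow (by positivity)]; simp
  · have h1 : (0 : ℝ) < g ^ (p / 2) := by positivity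
    rw [← Real.rpow_natCast, ← Real.rpow_mul (by positivity), Real.div_rpow h1.le hT.le,
      ← Real.rpow_mul hg.le, div_div_eq_mul_div, div_eq_iff (by positivity), mul_right_comm,
      ← Real.rpow_add hg]
    have e1 : p / 2 + p / 2 * (α * (2 : ℕ)) = 1 := by subst hα; push_cast; field_simp; ring
    have e2 : α * (2 : ℕ) = 2 / p - 1 := by subst hα; push_cast; ring
    rw [e1, e2, Real.rpow_one]

variable {κ : Type*} [Fintype κ]

lemma diag_conj_sum_mul_self {U : Matrix ι ι ℂ} (hU : U * Uᴴ = 1) (a : κ → Matrix ι ι ℂ) (j : ι) :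
    ((Uᴴ * (∑ k, (a k)ᴴ * a k) * U) j j).re = ∑ k, ∑ i, ‖(Uᴴ * a k * U) i j‖ ^ 2 := by
  have h : Uᴴ * (∑ k, (a k)ᴴ * a k) * U = ∑ k, (Uᴴ * a k * U)ᴴ * (Uᴴ * a k * U) := by
    rw [Finset.mul_sum, Finset.sum_mul]
    refine Finset.sum_congr rfl fun k _ => ?_
    have : (Uᴴ * a k * U)ᴴ * (Uᴴ * a k * U) = Uᴴ * ((a k)ᴴ * (U * Uᴴ) * a k) * U := by
      simp only [conjTranspose_mul, conjTranspose_conjTranspose, mul_assoc]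
    rw [this, hU, mul_one]
  rw [h, Matrix.sum_apply, Complex.re_sum]
  refine Finset.sum_congr rfl fun k _ => ?_
  rw [mul_apply, Complex.re_sum]
  refine Finset.sum_congr rfl fun i _ => ?_
  have := Complex.conj_mul' ((Uᴴ * a k * U) i j)
  simp only [conjTranspose_apply (M := Uᴴ * a k * U), RCLike.star_def, this]
  norm_cast

lemma diag_conj_sum_self_mul {U : Matrix ι ι ℂ} (hU : U * Uᴴ = 1) (b : κ → Matrix ι ι ℂ) (j : ι) :
    ((Uᴴ * (∑ k, b k * (b k)ᴴ) * U) j j).re = ∑ k, ∑ i, ‖(Uᴴ * b k * U) j i‖ ^ 2 := by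
  have := diag_conj_sum_mul_self hU (fun k => (b k)ᴴ) j
  simp only [conjTranspose_conjTranspose] at this
  rw [this]
  refine Finset.sum_congr rfl fun k _ => Finset.sum_congr rfl fun i _ => ?_
  have h : Uᴴ * (b k)ᴴ * U = (Uᴴ * b k * U)ᴴ := by
    simp only [conjTranspose_mul, conjTranspose_conjTranspose, mul_assoc]
  rw [h, conjTranspose_apply, norm_star]

lemma exists_factorization {p α : ℝ} (hp0 : 0 < p) (hp2 : p < 2) (hα : α = 1 / p - 1 / 2)
    (a b : κ → Matrix ι ι ℂ) (hP : (∑ k, (a k)ᴴ * a k).PosSemidef)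
    (hQ : (∑ k, b k * (b k)ᴴ).PosSemidef) (hab : ∃ k, a k + b k ≠ 0) :
    ∃ (f : Matrix ι ι ℂ) (y : κ → Matrix ι ι ℂ), f.PosSemidef ∧ f.trace = 1 ∧
      (∀ k, a k + b k = (1 / 2 : ℂ) • (posPow f α * y k + y k * posPow f α)) ∧
      ∑ k, schattenNorm 2 (y k) ^ 2 ≤ 8 * (∑ i, hP.1.eigenvalues i ^ (p / 2) +
        ∑ i, hQ.1.eigenvalues i ^ (p / 2)) ^ (2 / p) := by
  set P := ∑ k, (a k)ᴴ * a k with hPdef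
  set Q := ∑ k, b k * (b k)ᴴ with hQdef
  have hG : (P + Q).PosSemidef := hP.add hQ
  have hq0 : 0 < p / 2 := by positivity
  have hαpos : 0 < α := by
    rw [hα, sub_pos]; exact one_div_lt_one_div_of_lt hp0 hp2
  have hrot := sum_eigenvalues_add_rpow_le hP hQ hG hq0 (by linarith)
  set U := (hG.1.eigenvectorUnitary : Matrix ι ι ℂ) with hU
  have hUU : Uᴴ * U = 1 := Unitary.coe_star_mul_self _
  have hU' : U * Uᴴ = 1 := Unitary.coe_mul_star_self _
  set g := hG.1.eigenvalues with hg
  have hg0 : ∀ j, 0 ≤ g j := hG.eigenvalues_nonneg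
  have hgsum (j) : ∑ k, ∑ i, ‖(Uᴴ * a k * U) i j‖ ^ 2 +
      ∑ k, ∑ i, ‖(Uᴴ * b k * U) j i‖ ^ 2 = g j := by
    rw [← diag_conj_sum_mul_self hU', ← diag_conj_sum_self_mul hU', ← Complex.add_re,
      ← Matrix.add_apply, ← add_mul, ← mul_add]
    exact hG.1.diag_eq j
  have ha0 (k i j) (h : g j = 0) : (Uᴴ * a k * U) i j = 0 := by
    have h1 := hgsum j
    rw [h] at h1
    have h2 : ∑ k, ∑ i, ‖(Uᴴ * a k * U) i j‖ ^ 2 = 0 :=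
      le_antisymm (by rw [← h1]; exact le_add_of_nonneg_right (by positivity)) (by positivity)
    rw [Finset.sum_eq_zero_iff_of_nonneg (fun _ _ => by positivity)] at h2
    have h3 := h2 k (Finset.mem_univ _)
    rw [Finset.sum_eq_zero_iff_of_nonneg (fun _ _ => by positivity)] at h3
    simpa using h3 i (Finset.mem_univ _)
  have hb0 (k i j) (h : g i = 0) : (Uᴴ * b k * U) i j = 0 := by
    have h1 := hgsum i
    rw [h] at h1
    have h2 : ∑ k, ∑ j, ‖(Uᴴ * b k * U) i j‖ ^ 2 = 0 :=
      le_antisymm (by rw [← h1]; exact le_add_of_nonneg_left (by positivity)) (by positivity)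
    rw [Finset.sum_eq_zero_iff_of_nonneg (fun _ _ => by positivity)] at h2
    have h3 := h2 k (Finset.mem_univ _)
    rw [Finset.sum_eq_zero_iff_of_nonneg (fun _ _ => by positivity)] at h3
    simpa using h3 j (Finset.mem_univ _)
  have hconj (M : Matrix ι ι ℂ) : U * (Uᴴ * M * U) * Uᴴ = M := by
    have : U * (Uᴴ * M * U) * Uᴴ = (U * Uᴴ) * M * (U * Uᴴ) := by simp only [mul_assoc]
    rw [this, hU', one_mul, mul_one]
  set T := ∑ j, g j ^ (p / 2) with hTdef
  have hT : 0 < T := by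
    have hTn : ∀ j ∈ Finset.univ, 0 ≤ g j ^ (p / 2) := fun j _ => Real.rpow_nonneg (hg0 j) _
    refine (Finset.sum_nonneg hTn).lt_of_ne' fun h => ?_
    have hgz (j) : g j = 0 :=
      (Real.rpow_eq_zero (hg0 j) hq0.ne').1
        ((Finset.sum_eq_zero_iff_of_nonneg hTn).1 h j (Finset.mem_univ _))
    obtain ⟨k, hk⟩ := hab
    refine hk ?_
    rw [← hconj (a k + b k)]
    have : Uᴴ * (a k + b k) * U = 0 := by
      ext i j
      rw [mul_add, add_mul, Matrix.add_apply, ha0 k i j (hgz j), hb0 k i j (hgz i)]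
      simp
    rw [this]; simp
  set d : ι → ℝ := fun j => (g j ^ (p / 2) / T) ^ α with hd
  have hd0 (j) : 0 ≤ d j := Real.rpow_nonneg (div_nonneg (Real.rpow_nonneg (hg0 j) _) hT.le) _
  have hdg (j) (h : d j = 0) : g j = 0 := by
    have h1 := (Real.rpow_eq_zero (div_nonneg (Real.rpow_nonneg (hg0 j) _) hT.le) hαpos.ne').1 h
    rcases div_eq_zero_iff.1 h1 with h2 | h2
    · exact (Real.rpow_eq_zero (hg0 j) hq0.ne').1 h2
    · exact absurd h2 hT.ne'
  obtain ⟨Y, hY⟩ : ∃ Y : κ → Matrix ι ι ℂ, ∀ k i j, Y k i j =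
      2 * ((Uᴴ * a k * U) i j + (Uᴴ * b k * U) i j) / ((d i + d j : ℝ) : ℂ) :=
    ⟨fun k => Matrix.of fun i j => _, fun _ _ _ => rfl⟩
  have hpow : posPow (cfc (fun t : ℝ => t ^ (p / 2) / T) (P + Q)) α =
      U * diagonal (fun j => (d j : ℂ)) * Uᴴ := by
    rw [posPow_cfc hG.1, hG.1.cfc_eq_mul]
  refine ⟨cfc (fun t : ℝ => t ^ (p / 2) / T) (P + Q), fun k => U * Y k * Uᴴ, ?_, ?_, ?_, ?_⟩
  · rw [hG.1.cfc_eq_mul]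
    refine PosSemidef.mul_mul_conjTranspose_same (PosSemidef.diagonal fun i => ?_) _
    exact Complex.zero_le_real.2 (div_nonneg (Real.rpow_nonneg (hg0 i) _) hT.le)
  · rw [trace_cfc hG.1, ← Finset.sum_div, div_self hT.ne', Complex.ofReal_one]
  · intro k
    rw [hpow]
    set D := diagonal (fun j => (d j : ℂ)) with hD
    have e1 : U * D * Uᴴ * (U * Y k * Uᴴ) + U * Y k * Uᴴ * (U * D * Uᴴ) =
        U * (D * (Uᴴ * U) * Y k + Y k * (Uᴴ * U) * D) * Uᴴ := by
      simp only [mul_assoc, mul_add, add_mul]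
    rw [e1, hUU, mul_one, mul_one, ← smul_mul_assoc, ← mul_smul_comm]
    conv_lhs => rw [← hconj (a k + b k)]
    congr 2
    ext i j
    rw [mul_add, add_mul, Matrix.add_apply, Matrix.smul_apply, Matrix.add_apply, hD,
      diagonal_mul, mul_diagonal, hY, smul_eq_mul]
    rcases eq_or_ne (d i + d j) 0 with h | h
    · have hi : d i = 0 := by linarith [hd0 i, hd0 j]
      have hj : d j = 0 := by linarith [hd0 i, hd0 j]
      rw [ha0 k i j (hdg j hj), hb0 k i j (hdg i hi)]
      simp
    · have h' : ((d i : ℂ) + d j) ≠ 0 := by exact_mod_cast h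
      push_cast
      field_simp
  · have hnorm (k) : schattenNorm 2 (U * Y k * Uᴴ) ^ 2 = ∑ j, ∑ i, ‖Y k i j‖ ^ 2 := by
      rw [schattenNorm_two_sq, ← trace_conjTranspose_mul_self_re]
      have e : (U * Y k * Uᴴ)ᴴ * (U * Y k * Uᴴ) = U * ((Y k)ᴴ * (Uᴴ * U) * Y k * Uᴴ) := by
        simp only [conjTranspose_mul, conjTranspose_conjTranspose, mul_assoc]
      rw [e, hUU, mul_one, trace_mul_comm, mul_assoc, hUU, mul_one]
    simp_rw [hnorm]
    calc ∑ k, ∑ j, ∑ i, ‖Y k i j‖ ^ 2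
        ≤ ∑ k, ∑ j, ∑ i, 8 * (‖(Uᴴ * a k * U) i j‖ ^ 2 / d j ^ 2 +
            ‖(Uᴴ * b k * U) i j‖ ^ 2 / d i ^ 2) := by
          refine Finset.sum_le_sum fun k _ => Finset.sum_le_sum fun j _ =>
            Finset.sum_le_sum fun i _ => ?_
          rw [hY]
          exact norm_two_mul_add_div_sq_le (hd0 i) (hd0 j) (fun h => ha0 k i j (hdg j h))
            fun h => hb0 k i j (hdg i h)
      _ = 8 * ∑ j, g j / d j ^ 2 := by
          simp_rw [← Finset.mul_sum, Finset.sum_add_distrib]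
          congr 1
          have e1 : ∑ k, ∑ j, ∑ i, ‖(Uᴴ * a k * U) i j‖ ^ 2 / d j ^ 2 =
              ∑ j, (∑ k, ∑ i, ‖(Uᴴ * a k * U) i j‖ ^ 2) / d j ^ 2 := by
            rw [Finset.sum_comm]
            simp_rw [Finset.sum_div]
          have e2 : ∑ k, ∑ j, ∑ i, ‖(Uᴴ * b k * U) i j‖ ^ 2 / d i ^ 2 =
              ∑ j, (∑ k, ∑ i, ‖(Uᴴ * b k * U) j i‖ ^ 2) / d j ^ 2 := by
            rw [Finset.sum_congr rfl fun k _ => Finset.sum_comm, Finset.sum_comm]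
            simp_rw [Finset.sum_div]
          rw [e1, e2, ← Finset.sum_add_distrib]
          simp_rw [← add_div, hgsum]
      _ = 8 * T ^ (2 / p) := by
          simp_rw [hd, div_rpow_sq_eq hp0 hα (hg0 _) hT]
          rw [← Finset.sum_mul, ← hTdef]
          congr 1
          conv_lhs => rw [← Real.rpow_one T, ← Real.rpow_mul hT.le, ← Real.rpow_add hT]
          congr 1; ring
      _ ≤ _ := by gcongr
end

lemma norm_le_schattenNorm_posPow_half {ι κ : Type*} [Fintype ι] [DecidableEq ι] [Fintype κ]
    {p : ℝ} (hp0 : 0 < p) (hp2 : p < 2) (a : κ → Matrix ι ι ℂ)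
    (hP : (∑ k, (a k)ᴴ * a k).PosSemidef) (k : κ) (i j : ι) :
    ‖a k i j‖ ≤ schattenNorm p (posPow (∑ k, (a k)ᴴ * a k) (1 / 2)) := by
  rw [schattenNorm_posPow_half hP]
  have h0 := Real.sum_rpow_le Finset.univ (half_pos hp0) (by linarith) hP.eigenvalues_nonneg
  have htr : ∑ i, hP.1.eigenvalues i = ∑ k, ∑ j, ∑ i, ‖a k i j‖ ^ 2 := by
    have h1 := congrArg Complex.re hP.1.trace_eq_sum_eigenvalues
    rw [trace_sum, Complex.re_sum] at h1
    simp_rw [trace_conjTranspose_mul_self_re] at h1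
    rw [h1]
    simp
  have h2 : ‖a k i j‖ ^ 2 ≤ ∑ i, hP.1.eigenvalues i := by
    rw [htr]
    calc ‖a k i j‖ ^ 2 ≤ ∑ i, ‖a k i j‖ ^ 2 :=
          Finset.single_le_sum (f := fun i => ‖a k i j‖ ^ 2) (fun _ _ => by positivity)
            (Finset.mem_univ i)
      _ ≤ ∑ j, ∑ i, ‖a k i j‖ ^ 2 :=
          Finset.single_le_sum (f := fun j => ∑ i, ‖a k i j‖ ^ 2) (fun _ _ => by positivity)
            (Finset.mem_univ j)
      _ ≤ _ := Finset.single_le_sum (f := fun k => ∑ j, ∑ i, ‖a k i j‖ ^ 2)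
            (fun _ _ => by positivity) (Finset.mem_univ k)
  have h3 : ‖a k i j‖ ^ p ≤ ∑ i, hP.1.eigenvalues i ^ (p / 2) := by
    refine le_trans ?_ h0
    calc ‖a k i j‖ ^ p = (‖a k i j‖ ^ 2) ^ (p / 2) := by
          rw [← Real.rpow_natCast, ← Real.rpow_mul (norm_nonneg _)]
          congr 1; push_cast; ring
      _ ≤ _ := by gcongr
  calc ‖a k i j‖ = (‖a k i j‖ ^ p) ^ (1 / p) := by
        rw [one_div, Real.rpow_rpow_inv (norm_nonneg _) hp0.ne']
    _ ≤ _ := by gcongr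

lemma posSemidef_sum_conjTranspose_mul_self {ι κ : Type*} [Fintype ι] [Fintype κ]
    (a : κ → Matrix ι ι ℂ) : (∑ k, (a k)ᴴ * a k).PosSemidef :=
  posSemidef_sum _ fun k _ => posSemidef_conjTranspose_mul_self (a k)

lemma posSemidef_sum_self_mul_conjTranspose {ι κ : Type*} [Fintype ι] [Fintype κ]
    (b : κ → Matrix ι ι ℂ) : (∑ k, b k * (b k)ᴴ).PosSemidef :=
  posSemidef_sum _ fun k _ => posSemidef_self_mul_conjTranspose (b k)

lemma schattenNorm_posPow_half_nonneg {ι : Type*} [Fintype ι] [DecidableEq ι] {A : Matrix ι ι ℂ}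
    (hA : A.PosSemidef) (p : ℝ) : 0 ≤ schattenNorm p (posPow A (1 / 2)) := by
  rw [schattenNorm_posPow_half hA]
  exact Real.rpow_nonneg
    (Finset.sum_nonneg fun i _ => Real.rpow_nonneg (hA.eigenvalues_nonneg i) _) _

lemma norm_apply_le_tripleNorm {n N : ℕ} {p : ℝ} (hp0 : 0 < p) (hp2 : p < 2)
    (x : Fin N → Matrix (Fin n) (Fin n) ℂ) (k : Fin N) (i j : Fin n) :
    ‖x k i j‖ ≤ tripleNorm p x := by
  refine le_csInf ⟨_, x, 0, fun k => by simp, rfl⟩ ?_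
  rintro r ⟨a, b, hx, rfl⟩
  have h1 := norm_le_schattenNorm_posPow_half hp0 hp2 a
    (posSemidef_sum_conjTranspose_mul_self a) k i j
  have h2 := norm_le_schattenNorm_posPow_half hp0 hp2 (fun k => (b k)ᴴ)
    (posSemidef_sum_conjTranspose_mul_self _) k j i
  simp only [conjTranspose_conjTranspose, conjTranspose_apply, norm_star] at h2
  rw [hx k, Matrix.add_apply]
  exact (norm_add_le _ _).trans (add_le_add h1 h2)

lemma rpow_add_rpow_rpow_le {p s t : ℝ} (hp0 : 0 < p) (hs : 0 ≤ s) (ht : 0 ≤ t) :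
    (8 * (s + t) ^ (2 / p)) ^ (1 / 2 : ℝ) ≤
      √8 * 2 ^ (1 / p) * (s ^ (1 / p) + t ^ (1 / p)) := by
  have h1 : (8 * (s + t) ^ (2 / p)) ^ (1 / 2 : ℝ) = √8 * (s + t) ^ (1 / p) := by
    rw [Real.mul_rpow (by norm_num) (by positivity), ← Real.rpow_mul (by positivity),
      Real.sqrt_eq_rpow]
    congr 2; ring
  rw [h1, mul_assoc]
  gcongr
  have h2 : s + t ≤ 2 * max s t := by linarith [le_max_left s t, le_max_right s t]
  calc (s + t) ^ (1 / p) ≤ (2 * max s t) ^ (1 / p) := by gcongr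
    _ = 2 ^ (1 / p) * max s t ^ (1 / p) :=
        Real.mul_rpow (by norm_num) (hs.trans (le_max_left s t))
    _ ≤ _ := by
        gcongr
        rcases max_choice s t with h | h <;> rw [h]
        · exact le_add_of_nonneg_right (by positivity)
        · exact le_add_of_nonneg_left (by positivity)

/-- Step 2: factorization of a finite sequence through a density. -/
theorem statement16 (p α : ℝ) (hp0 : 0 < p) (hp2 : p < 2) (hα : α = 1/p - 1/2) :
    ∃ C : ℝ, 0 < C ∧ ∀ (n N : ℕ), 1 ≤ n →
      ∀ x : Fin N → Matrix (Fin n) (Fin n) ℂ,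
      ∃ (f : Matrix (Fin n) (Fin n) ℂ) (y : Fin N → Matrix (Fin n) (Fin n) ℂ),
        f.PosSemidef ∧ f.trace = 1 ∧
        (∀ k, x k = (1/2 : ℂ) • (posPow f α * y k + y k * posPow f α)) ∧
        (∑ k, schattenNorm 2 (y k) ^ 2) ^ (1/2 : ℝ) ≤ C * tripleNorm p x := by
  have hC : 0 < √8 * (2 : ℝ) ^ (1 / p) := by positivity
  refine ⟨√8 * 2 ^ (1 / p) * 2, by positivity, fun n N hn x => ?_⟩
  by_cases hx : ∃ k, x k ≠ 0
  · have hpos : 0 < tripleNorm p x := by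
      obtain ⟨k, hk⟩ := hx
      obtain ⟨i, j, hij⟩ : ∃ i j, x k i j ≠ 0 := by
        by_contra! h
        exact hk (Matrix.ext h)
      exact (norm_pos_iff.2 hij).trans_le (norm_apply_le_tripleNorm hp0 hp2 x k i j)
    obtain ⟨r, ⟨a, b, hab, rfl⟩, hr⟩ := exists_lt_of_csInf_lt
      (s := { r : ℝ | ∃ a b : Fin N → Matrix (Fin n) (Fin n) ℂ,
        (∀ k, x k = a k + b k) ∧
        r = schattenNorm p (posPow (∑ k, (a k)ᴴ * a k) (1/2))
          + schattenNorm p (posPow (∑ k, b k * (b k)ᴴ) (1/2)) })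
      ⟨_, x, 0, fun k => by simp, rfl⟩ (show tripleNorm p x < 2 * tripleNorm p x by linarith)
    have hP := posSemidef_sum_conjTranspose_mul_self a
    have hQ := posSemidef_sum_self_mul_conjTranspose b
    obtain ⟨f, y, hf, hf1, hy, hle⟩ := exists_factorization hp0 hp2 hα a b hP hQ
      (by simpa only [hab] using hx)
    refine ⟨f, y, hf, hf1, fun k => (hab k).trans (hy k), ?_⟩
    rw [schattenNorm_posPow_half hP, schattenNorm_posPow_half hQ] at hr
    have hs := Finset.sum_nonneg fun i (_ : i ∈ Finset.univ) =>
      Real.rpow_nonneg (hP.eigenvalues_nonneg i) (p / 2)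
    have ht := Finset.sum_nonneg fun i (_ : i ∈ Finset.univ) =>
      Real.rpow_nonneg (hQ.eigenvalues_nonneg i) (p / 2)
    calc _ ≤ _ := Real.rpow_le_rpow (by positivity) hle (by norm_num)
      _ ≤ _ := rpow_add_rpow_rpow_le hp0 hs ht
      _ ≤ _ := by
        rw [mul_assoc _ 2]
        exact mul_le_mul_of_nonneg_left hr.le hC.le
  · push Not at hx
    have hn' : (n : ℂ) ≠ 0 := by exact_mod_cast (by omega : n ≠ 0)
    refine ⟨diagonal fun _ => (n : ℂ)⁻¹, 0, PosSemidef.diagonal fun i => ?_, ?_,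
      fun k => by simp [hx k], ?_⟩
    · exact inv_nonneg.2 (Nat.cast_nonneg n)
    · simp [trace_diagonal, hn']
    · have h0 : 0 ≤ tripleNorm p x := by
        refine Real.sInf_nonneg ?_
        rintro r ⟨a, b, -, rfl⟩
        exact add_nonneg
          (schattenNorm_posPow_half_nonneg (posSemidef_sum_conjTranspose_mul_self a) p)
          (schattenNorm_posPow_half_nonneg (posSemidef_sum_self_mul_conjTranspose b) p)
      simp only [Pi.zero_apply, schattenNorm_two_sq, mul_zero, trace_zero, Complex.zero_re,
        Finset.sum_const_zero]
      rw [Real.zero_rpow (by norm_num)]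
      positivity
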